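/- For all m₁, m₂, n₁, n₂ ∈ ℕ with n₁ ≥ m₁ and n₂ ≥ m₂, the product state b^{(4)}_{m,n}(q¹,π¹,q²,π²) = f_{m₁,n₁}(q¹,π¹) f_{m₂,n₂}(q²,π²) satisfies b^{(4)}_{m,n} ⋆ H₀ = ħ(n₁ + n₂ + 1) b^{(4)}_{m,n}. -/

import Mathlib

open Complex Real

/-- Phase-space functions on ℝ⁴ with coordinates (q¹, π¹, q², π²). -/
abbrev PhaseFn := ℝ → ℝ → ℝ → ℝ → ℂ

/-- Partial derivative with respect to q¹. -/
noncomputable def pdQ1 (F : PhaseFn) : PhaseFn :=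
  fun q1 p1 q2 p2 => deriv (fun t => F t p1 q2 p2) q1

/-- Partial derivative with respect to π¹. -/
noncomputable def pdP1 (F : PhaseFn) : PhaseFn :=
  fun q1 p1 q2 p2 => deriv (fun t => F q1 t q2 p2) p1

/-- Partial derivative with respect to q². -/
noncomputable def pdQ2 (F : PhaseFn) : PhaseFn :=
  fun q1 p1 q2 p2 => deriv (fun t => F q1 p1 t p2) q2

/-- Partial derivative with respect to π². -/
noncomputable def pdP2 (F : PhaseFn) : PhaseFn :=
  fun q1 p1 q2 p2 => deriv (fun t => F q1 p1 q2 t) p2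

/-- The family (∂_{q^l})_{l=1,2}. -/
noncomputable def dQ : Fin 2 → PhaseFn → PhaseFn := ![pdQ1, pdQ2]

/-- The family (∂_{π^l})_{l=1,2}. -/
noncomputable def dP : Fin 2 → PhaseFn → PhaseFn := ![pdP1, pdP2]

/-- First-order bidifferential operator
`P₁(f,g) = Σ_l (∂_{q^l} f ∂_{π^l} g − ∂_{π^l} f ∂_{q^l} g)`. -/
noncomputable def P1 (F G : PhaseFn) : PhaseFn :=
  fun q1 p1 q2 p2 =>
    ∑ l : Fin 2,
      (dQ l F q1 p1 q2 p2 * dP l G q1 p1 q2 p2 -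
        dP l F q1 p1 q2 p2 * dQ l G q1 p1 q2 p2)

/-- Second-order bidifferential operator
`P₂(f,g) = Σ_{l,l'} (∂_{q^l}∂_{q^{l'}} f ∂_{π^l}∂_{π^{l'}} g
  − 2 ∂_{q^l}∂_{π^{l'}} f ∂_{π^l}∂_{q^{l'}} g + ∂_{π^l}∂_{π^{l'}} f ∂_{q^l}∂_{q^{l'}} g)`. -/
noncomputable def P2 (F G : PhaseFn) : PhaseFn :=
  fun q1 p1 q2 p2 =>
    ∑ l : Fin 2, ∑ l' : Fin 2,
      (dQ l (dQ l' F) q1 p1 q2 p2 * dP l (dP l' G) q1 p1 q2 p2 -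
        2 * dQ l (dP l' F) q1 p1 q2 p2 * dP l (dQ l' G) q1 p1 q2 p2 +
        dP l (dP l' F) q1 p1 q2 p2 * dQ l (dQ l' G) q1 p1 q2 p2)

/-- Moyal star product, truncated (exactly) at second order:
valid when one factor is a polynomial of degree ≤ 2, in which case
`f ⋆ g = fg + (iℏ/2)P₁(f,g) + (1/2)(iℏ/2)² P₂(f,g)`. -/
noncomputable def moyal (ℏ : ℝ) (F G : PhaseFn) : PhaseFn :=
  fun q1 p1 q2 p2 =>
    F q1 p1 q2 p2 * G q1 p1 q2 p2 +
      (Complex.I * (ℏ : ℂ) / 2) * P1 F G q1 p1 q2 p2 +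
      (1 / 2) * (Complex.I * (ℏ : ℂ) / 2) ^ 2 * P2 F G q1 p1 q2 p2

/-- `H₀ = ½((q¹)² + (q²)² + (π¹)² + (π²)²)`. -/
noncomputable def H0 : PhaseFn :=
  fun q1 p1 q2 p2 => (((q1 ^ 2 + q2 ^ 2 + p1 ^ 2 + p2 ^ 2) / 2 : ℝ) : ℂ)

/-- `H_L = −((Θ+Θ̄)/2ℏ)(q¹π² − q²π¹)`. -/
noncomputable def HL (ℏ Θ Θbar : ℝ) : PhaseFn :=
  fun q1 p1 q2 p2 => ((-((Θ + Θbar) / (2 * ℏ)) * (q1 * p2 - q2 * p1) : ℝ) : ℂ)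

/-- `H_q = (Θ̄²/8ℏ²)((q¹)² + (q²)²)`. -/
noncomputable def Hq (ℏ Θbar : ℝ) : PhaseFn :=
  fun q1 p1 q2 p2 => ((Θbar ^ 2 / (8 * ℏ ^ 2) * (q1 ^ 2 + q2 ^ 2) : ℝ) : ℂ)

/-- `H_π = (Θ²/8ℏ²)((π¹)² + (π²)²)`. -/
noncomputable def Hpi (ℏ Θ : ℝ) : PhaseFn :=
  fun q1 p1 q2 p2 => ((Θ ^ 2 / (8 * ℏ ^ 2) * (p1 ^ 2 + p2 ^ 2) : ℝ) : ℂ)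

/-- Generalized Laguerre polynomial
`L_m^α(x) = Σ_{k=0}^{m} (Γ(m+α+1)/Γ(k+α+1)) (−x)^k/(k!(m−k)!)` (natural α). -/
noncomputable def genLaguerre (m α : ℕ) (x : ℝ) : ℝ :=
  ∑ k ∈ Finset.range (m + 1),
    (Real.Gamma ((m : ℝ) + α + 1) / Real.Gamma ((k : ℝ) + α + 1)) * (-x) ^ k /
      ((k.factorial : ℝ) * ((m - k).factorial : ℝ))

/-- Wigner eigenfunction
`f_{m,n}(q,π) = 2(−1)^m √(m!/n!) (2/ℏ)^{(n−m)/2} (q+iπ)^{n−m}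
  L_m^{n−m}(2(q²+π²)/ℏ) e^{−(q²+π²)/ℏ}` (for n ≥ m). -/
noncomputable def wignerF (ℏ : ℝ) (m n : ℕ) (q p : ℝ) : ℂ :=
  2 * (-1) ^ m * (Real.sqrt ((m.factorial : ℝ) / (n.factorial : ℝ)) : ℂ) *
    ((Real.sqrt (2 / ℏ) : ℂ)) ^ (n - m) * ((q : ℂ) + Complex.I * (p : ℂ)) ^ (n - m) *
    ((genLaguerre m (n - m) (2 * (q ^ 2 + p ^ 2) / ℏ) : ℝ) : ℂ) *
    (Real.exp (-(q ^ 2 + p ^ 2) / ℏ) : ℂ)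

/-- Product state `b⁴_{m,n}(q¹,π¹,q²,π²) = f_{m₁,n₁}(q¹,π¹) f_{m₂,n₂}(q²,π²)`. -/
noncomputable def b4 (ℏ : ℝ) (m1 n1 m2 n2 : ℕ) : PhaseFn :=
  fun q1 p1 q2 p2 => wignerF ℏ m1 n1 q1 p1 * wignerF ℏ m2 n2 q2 p2

open Polynomial in
/-- The generalized Laguerre polynomial, as an element of `ℝ[X]`. -/
noncomputable def laguerrePoly (m α : ℕ) : ℝ[X] :=
  ∑ k ∈ Finset.range (m + 1), Polynomial.monomial k
    ((-1) ^ k * ((m + α).factorial : ℝ) /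
      (((k + α).factorial : ℝ) * (k.factorial : ℝ) * ((m - k).factorial : ℝ)))

theorem laguerrePoly_eval (m α : ℕ) (x : ℝ) :
    (laguerrePoly m α).eval x = genLaguerre m α x := by
  simp only [laguerrePoly, genLaguerre, Polynomial.eval_finsetSum, Polynomial.eval_monomial]
  refine Finset.sum_congr rfl fun k _ => ?_
  rw [← Nat.cast_add, ← Nat.cast_add, Real.Gamma_nat_eq_factorial, Real.Gamma_nat_eq_factorial,
    neg_pow x k]
  field_simp

theorem laguerrePoly_coeff (m α k : ℕ) :
    (laguerrePoly m α).coeff k = if k ≤ m then (-1) ^ k * ((m + α).factorial : ℝ) /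
      (((k + α).factorial : ℝ) * (k.factorial : ℝ) * ((m - k).factorial : ℝ)) else 0 := by
  simp [laguerrePoly, Polynomial.finsetSum_coeff, Polynomial.coeff_monomial]

theorem laguerrePoly_coeff_succ (m α k : ℕ) :
    ((k : ℝ) + 1) * (k + 1 + α) * (laguerrePoly m α).coeff (k + 1) =
      ((k : ℝ) - m) * (laguerrePoly m α).coeff k := by
  rw [laguerrePoly_coeff, laguerrePoly_coeff]
  rcases lt_trichotomy k m with h | rfl | h
  · obtain ⟨d, rfl⟩ := Nat.exists_eq_add_of_lt h
    rw [if_pos (by omega), if_pos (by omega), show k + d + 1 - (k + 1) = d by omega,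
      show k + d + 1 - k = d + 1 by omega, show k + 1 + α = k + α + 1 by omega,
      Nat.factorial_succ (k + α), Nat.factorial_succ k, Nat.factorial_succ d]
    have h1 : ((k : ℝ) + α + 1) ≠ 0 := by positivity
    push_cast
    field_simp
    ring
  · simp
  · rw [if_neg (by omega), if_neg (by omega)]
    simp

open Polynomial in
/-- Laguerre's differential equation `x L'' + (α + 1 - x) L' + m L = 0`. -/
theorem laguerrePoly_ode (m α : ℕ) :
    X * derivative (derivative (laguerrePoly m α)) + C ((α : ℝ) + 1) *
      derivative (laguerrePoly m α) - X * derivative (laguerrePoly m α) +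
      C (m : ℝ) * laguerrePoly m α = 0 := by
  ext k
  have h := laguerrePoly_coeff_succ m α k
  cases k with
  | zero =>
    simp only [coeff_add, coeff_sub, coeff_derivative, mul_coeff_zero, coeff_X_zero,
      coeff_C_zero, coeff_zero]
    push_cast at h ⊢
    linear_combination h
  | succ k =>
    simp only [coeff_add, coeff_sub, coeff_C_mul, coeff_derivative, coeff_X_mul, coeff_zero]
    push_cast at h ⊢
    linear_combination h

/-- Right star multiplication by `(q² + π²)/2` on functions of one pair of variables. -/
noncomputable def starOscillator (ℏ : ℝ) (f : ℝ → ℝ → ℂ) (q p : ℝ) : ℂ :=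
  f q p * (((q : ℂ) ^ 2 + (p : ℂ) ^ 2) / 2) +
    (Complex.I * (ℏ : ℂ) / 2) *
      (deriv (fun t => f t p) q * p - deriv (fun t => f q t) p * q) +
    (1 / 2) * (Complex.I * (ℏ : ℂ) / 2) ^ 2 *
      (deriv (fun s => deriv (fun t => f t p) s) q + deriv (fun s => deriv (fun t => f q t) s) p)

theorem deriv_sq_ofReal_div_two_add (a x : ℝ) (g : ℝ → ℝ)
    (hg : ∀ t, g t = t ^ 2 / 2 + a) : deriv (fun t => ((g t : ℝ) : ℂ)) x = (x : ℂ) := by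
  have h : HasDerivAt g x x := by
    rw [funext hg]
    simpa using (((hasDerivAt_id x).pow 2).div_const 2).add_const a
  exact h.ofReal_comp.deriv

theorem pdQ1_H0 : pdQ1 H0 = fun (q1 : ℝ) _ _ _ => (q1 : ℂ) := by
  funext q1 p1 q2 p2
  exact deriv_sq_ofReal_div_two_add ((q2 ^ 2 + p1 ^ 2 + p2 ^ 2) / 2) q1 _ fun t => by ring

theorem pdP1_H0 : pdP1 H0 = fun _ (p1 : ℝ) _ _ => (p1 : ℂ) := by
  funext q1 p1 q2 p2
  exact deriv_sq_ofReal_div_two_add ((q1 ^ 2 + q2 ^ 2 + p2 ^ 2) / 2) p1 _ fun t => by ring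

theorem pdQ2_H0 : pdQ2 H0 = fun _ _ (q2 : ℝ) _ => (q2 : ℂ) := by
  funext q1 p1 q2 p2
  exact deriv_sq_ofReal_div_two_add ((q1 ^ 2 + p1 ^ 2 + p2 ^ 2) / 2) q2 _ fun t => by ring

theorem pdP2_H0 : pdP2 H0 = fun _ _ _ (p2 : ℝ) => (p2 : ℂ) := by
  funext q1 p1 q2 p2
  exact deriv_sq_ofReal_div_two_add ((q1 ^ 2 + q2 ^ 2 + p1 ^ 2) / 2) p2 _ fun t => by ring

theorem deriv_complex_ofReal (x : ℝ) : deriv (fun t : ℝ => (t : ℂ)) x = 1 :=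
  (hasDerivAt_id x).ofReal_comp.deriv

/-- On product functions, right star multiplication by `H₀` obeys the Leibniz rule. -/
theorem moyal_mul_H0 (ℏ : ℝ) (f g : ℝ → ℝ → ℂ) (q1 p1 q2 p2 : ℝ) :
    moyal ℏ (fun q1 p1 q2 p2 => f q1 p1 * g q2 p2) H0 q1 p1 q2 p2 =
      starOscillator ℏ f q1 p1 * g q2 p2 + f q1 p1 * starOscillator ℏ g q2 p2 := by
  simp only [moyal, P1, P2, dQ, dP, Fin.sum_univ_two, Matrix.cons_val_zero, Matrix.cons_val_one,
    pdQ1_H0, pdP1_H0, pdQ2_H0, pdP2_H0]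
  simp only [pdQ1, pdP1, pdQ2, pdP2, deriv_const, deriv_complex_ofReal, deriv_mul_const_field,
    deriv_const_mul_field, starOscillator, H0]
  push_cast
  ring

/-- First derivative, in `t`, of a power of `a + c t` times a radial function. -/
theorem hasDerivAt_pow_mul_radial (α : ℕ) (a c : ℂ) (b : ℝ) {R R' : ℝ → ℝ}
    (hR : ∀ s, HasDerivAt R (R' s) s) (t : ℝ) :
    HasDerivAt (fun t : ℝ => (a + c * t) ^ α * (R (t ^ 2 + b) : ℂ))
      (α * (a + c * t) ^ (α - 1) * c * (R (t ^ 2 + b) : ℂ) +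
        (a + c * t) ^ α * ((R' (t ^ 2 + b) : ℂ) * (2 * t))) t := by
  have hz : HasDerivAt (fun t : ℝ => a + c * (t : ℂ)) c t := by
    simpa using ((hasDerivAt_id t).ofReal_comp.const_mul c).const_add a
  have hs : HasDerivAt (fun t : ℝ => t ^ 2 + b) (2 * t) t := by
    simpa using ((hasDerivAt_id t).pow 2).add_const b
  have h := (hz.pow α).mul ((hR _).comp t hs).ofReal_comp
  refine h.congr_deriv ?_
  simp

theorem deriv_deriv_pow_mul_radial (α : ℕ) (a c : ℂ) (b : ℝ) {R R' R'' : ℝ → ℝ}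
    (hR : ∀ s, HasDerivAt R (R' s) s) (hR' : ∀ s, HasDerivAt R' (R'' s) s) (t : ℝ) :
    deriv (fun s => deriv (fun t : ℝ => (a + c * t) ^ α * (R (t ^ 2 + b) : ℂ)) s) t =
      α * ((α - 1 : ℕ) : ℂ) * (a + c * t) ^ (α - 1 - 1) * c ^ 2 * (R (t ^ 2 + b) : ℂ) +
      4 * α * (a + c * t) ^ (α - 1) * c * t * (R' (t ^ 2 + b) : ℂ) +
      (a + c * t) ^ α * (4 * t ^ 2 * (R'' (t ^ 2 + b) : ℂ) + 2 * (R' (t ^ 2 + b) : ℂ)) := by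
  rw [funext fun s => (hasDerivAt_pow_mul_radial α a c b hR s).deriv]
  have hl : HasDerivAt (fun t : ℝ => 2 * (t : ℂ)) 2 t := by
    simpa using (hasDerivAt_id t).ofReal_comp.const_mul (2 : ℂ)
  have h1 := (hasDerivAt_pow_mul_radial (α - 1) a c b hR t).const_mul (α * c)
  have h2 := (hasDerivAt_pow_mul_radial α a c b hR' t).mul hl
  have h := (h1.add h2).deriv
  convert h using 1
  · congr 1
    funext s
    simp only [Pi.add_apply, Pi.mul_apply]
    ring
  · ring

/-- Star multiplication by the oscillator reduces to a radial operator on `(q + iπ)^α R(q² + π²)`. -/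
theorem starOscillator_pow_mul_radial (ℏ : ℝ) (α : ℕ) (K : ℂ) {R R' R'' : ℝ → ℝ}
    (hR : ∀ s, HasDerivAt R (R' s) s) (hR' : ∀ s, HasDerivAt R' (R'' s) s) (q p : ℝ) :
    starOscillator ℏ
      (fun q p => K * (((q : ℂ) + Complex.I * p) ^ α * (R (q ^ 2 + p ^ 2) : ℂ))) q p =
      K * (((q : ℂ) + Complex.I * p) ^ α *
        (((q ^ 2 + p ^ 2) / 2 * R (q ^ 2 + p ^ 2) + ℏ * α / 2 * R (q ^ 2 + p ^ 2) -
          ℏ ^ 2 / 2 * ((α + 1) * R' (q ^ 2 + p ^ 2) +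
            (q ^ 2 + p ^ 2) * R'' (q ^ 2 + p ^ 2)) : ℝ) : ℂ)) := by
  have eq (t : ℝ) : ((t : ℂ) + Complex.I * p) ^ α * (R (t ^ 2 + p ^ 2) : ℂ) =
      (Complex.I * p + 1 * t) ^ α * (R (t ^ 2 + p ^ 2) : ℂ) := by ring
  have ep (t : ℝ) : ((q : ℂ) + Complex.I * t) ^ α * (R (q ^ 2 + t ^ 2) : ℂ) =
      (q + Complex.I * t) ^ α * (R (t ^ 2 + q ^ 2) : ℂ) := by rw [add_comm (q ^ 2)]
  have hα : (α : ℂ) * ((q : ℂ) + Complex.I * p) ^ (α - 1) * (q + Complex.I * p) =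
      α * ((q : ℂ) + Complex.I * p) ^ α := by
    cases α with
    | zero => simp
    | succ k => simp only [Nat.add_sub_cancel]; ring
  simp only [starOscillator, deriv_const_mul_field]
  rw [funext eq, funext ep, deriv_deriv_pow_mul_radial α _ _ _ hR hR',
    deriv_deriv_pow_mul_radial α _ _ _ hR hR', (hasDerivAt_pow_mul_radial α _ _ _ hR q).deriv,
    (hasDerivAt_pow_mul_radial α _ _ _ hR p).deriv, add_comm (p ^ 2) (q ^ 2),
    show Complex.I * (p : ℂ) + 1 * q = q + Complex.I * p by ring]
  push_cast
  generalize ((q : ℂ) + Complex.I * p) ^ α = A at *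
  generalize ((q : ℂ) + Complex.I * p) ^ (α - 1) = B at *
  generalize ((q : ℂ) + Complex.I * p) ^ (α - 1 - 1) = D at *
  linear_combination K * (ℏ / 2 * R (q ^ 2 + p ^ 2) - ℏ ^ 2 / 2 * R' (q ^ 2 + p ^ 2)) * hα +
    K / 2 * (A * ℏ ^ 2 * ((q ^ 2 + p ^ 2) * R'' (q ^ 2 + p ^ 2) + R' (q ^ 2 + p ^ 2)) -
      R (q ^ 2 + p ^ 2) * q * ℏ * α * B +
      R (q ^ 2 + p ^ 2) * Complex.I ^ 2 * ℏ ^ 2 * α * (α - 1 : ℕ) * D / 4 +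
      (q + Complex.I * p) * ℏ ^ 2 * α * B * R' (q ^ 2 + p ^ 2)) * Complex.I_sq

theorem wignerF_eq (ℏ : ℝ) (m n : ℕ) :
    wignerF ℏ m n = fun q p : ℝ =>
      (2 * (-1) ^ m * (Real.sqrt ((m.factorial : ℝ) / (n.factorial : ℝ)) : ℂ) *
        ((Real.sqrt (2 / ℏ) : ℂ)) ^ (n - m)) *
      (((q : ℂ) + Complex.I * (p : ℂ)) ^ (n - m) *
        (((laguerrePoly m (n - m)).eval (2 / ℏ * (q ^ 2 + p ^ 2)) *
          Real.exp (-(q ^ 2 + p ^ 2) / ℏ) : ℝ) : ℂ)) := by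
  funext q p
  rw [wignerF, laguerrePoly_eval, mul_div_right_comm]
  push_cast
  ring

theorem hasDerivAt_polynomial_mul_exp (ℏ : ℝ) (P : Polynomial ℝ) (s : ℝ) :
    HasDerivAt (fun s => P.eval (2 / ℏ * s) * Real.exp (-s / ℏ))
      ((Polynomial.C (2 / ℏ) * Polynomial.derivative P - Polynomial.C (1 / ℏ) * P).eval
        (2 / ℏ * s) * Real.exp (-s / ℏ)) s := by
  have h1 := (P.hasDerivAt (2 / ℏ * s)).comp s ((hasDerivAt_id s).const_mul (2 / ℏ))
  have h2 := ((hasDerivAt_id s).neg.div_const ℏ).exp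
  refine (h1.mul h2).congr_deriv ?_
  simp only [Polynomial.eval_sub, Polynomial.eval_mul, Polynomial.eval_C, Function.comp, id,
    Pi.neg_apply]
  ring

/-- The Wigner functions are right star eigenfunctions of the one-mode oscillator. -/
theorem starOscillator_wignerF (ℏ : ℝ) (hℏ : 0 < ℏ) (m n : ℕ) (h : m ≤ n) (q p : ℝ) :
    starOscillator ℏ (wignerF ℏ m n) q p = (ℏ : ℂ) * ((n : ℂ) + 1 / 2) * wignerF ℏ m n q p := by
  obtain ⟨α, rfl⟩ := Nat.exists_eq_add_of_le h
  rw [wignerF_eq, starOscillator_pow_mul_radial ℏ _ _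
    (hasDerivAt_polynomial_mul_exp ℏ _) (hasDerivAt_polynomial_mul_exp ℏ _)]
  rw [Nat.add_sub_cancel_left]
  set s := q ^ 2 + p ^ 2
  have hode := congrArg (Polynomial.eval (2 / ℏ * s)) (laguerrePoly_ode m α)
  simp only [Polynomial.eval_add, Polynomial.eval_sub, Polynomial.eval_mul, Polynomial.eval_C,
    Polynomial.eval_X, Polynomial.eval_zero] at hode
  have key (K Z : ℂ) (T U : ℝ) (hT : T = ℏ * ((m + α : ℕ) + 1 / 2) * U) :
      K * (Z * (T : ℂ)) = (ℏ : ℂ) * (((m + α : ℕ) : ℂ) + 1 / 2) * (K * (Z * (U : ℂ))) := by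
    rw [hT]
    push_cast
    ring
  apply key
  simp only [Polynomial.derivative_sub, Polynomial.derivative_mul, Polynomial.derivative_C,
    Polynomial.eval_sub, Polynomial.eval_mul, Polynomial.eval_C, Polynomial.eval_add,
    Polynomial.eval_zero]
  push_cast
  have hne := hℏ.ne'
  generalize Polynomial.eval (2 / ℏ * s) (laguerrePoly m α) = L0 at *
  generalize Polynomial.eval (2 / ℏ * s) (Polynomial.derivative (laguerrePoly m α)) = L1 at *
  generalize Polynomial.eval (2 / ℏ * s)
    (Polynomial.derivative (Polynomial.derivative (laguerrePoly m α))) = L2 at *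
  generalize Real.exp (-s / ℏ) = E
  field_simp at hode ⊢
  linear_combination (-2 * E) * hode

/-- `b⁴_{m,n} ⋆ H₀ = ℏ(n₁ + n₂ + 1) b⁴_{m,n}` for n₁ ≥ m₁, n₂ ≥ m₂. -/
theorem b4_star_H0 (ℏ : ℝ) (hℏ : 0 < ℏ) (m1 m2 n1 n2 : ℕ)
    (h1 : m1 ≤ n1) (h2 : m2 ≤ n2) :
    moyal ℏ (b4 ℏ m1 n1 m2 n2) H0 =
      fun q1 p1 q2 p2 =>
        ((ℏ : ℂ) * ((n1 : ℂ) + (n2 : ℂ) + 1)) * b4 ℏ m1 n1 m2 n2 q1 p1 q2 p2 := by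
  funext q1 p1 q2 p2
  unfold b4
  rw [moyal_mul_H0, starOscillator_wignerF ℏ hℏ m1 n1 h1, starOscillator_wignerF ℏ hℏ m2 n2 h2]
  ring
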